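/- arXiv:2410.20117 — 2 statements merged into one kernel-verified Lean document; each statement's English description precedes it below -/
import Mathlib

section
/- Let Φ(ρ) = Σ_{i=1}^N pᵢ Uᵢ ρ Uᵢ* be a mixed unitary channel on d×d complex matrices (pᵢ > 0, Σ pᵢ = 1, Uᵢ unitary), let 1 ≤ s ≤ d, and for k ∈ Fin d let E_kk denote the standard basis matrix with a single 1 in position (k,k). Then F(Φ(E_kk), Φ(E_ll)) = 0 for all k ≠ l with k, l < s if and only if there exist M ≥ 1, reals qₘ > 0 with Σ qₘ = 1, and d×d unitary matrices V₁,…,V_M such that Σₘ qₘ Vₘ X Vₘ* = Σᵢ pᵢ Uᵢ X Uᵢ* for all d×d matrices X and (Vₙ*Vₘ)(k,l) = 0 for all 1 ≤ m, n ≤ M and all indices k ≠ l with k, l < s. -/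
open Matrix ComplexOrder

/-- The positive semidefinite square root of a positive semidefinite matrix
(as in the older Mathlib, which had this definition). -/
noncomputable def Matrix.PosSemidef.sqrt {n 𝕜 : Type*} [Fintype n] [RCLike 𝕜] [DecidableEq n]
    {A : Matrix n n 𝕜} (hA : A.PosSemidef) : Matrix n n 𝕜 :=
  hA.1.eigenvectorUnitary.1 * diagonal ((↑) ∘ Real.sqrt ∘ hA.1.eigenvalues) *
    (star hA.1.eigenvectorUnitary : Matrix n n 𝕜)

/-- The positive semidefinite square root of a matrix (junk value `0` if not PSD). -/
noncomputable def psdSqrt {n : Type*} [Fintype n] [DecidableEq n]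
    (A : Matrix n n ℂ) : Matrix n n ℂ :=
  letI := Classical.propDecidable A.PosSemidef
  if h : A.PosSemidef then h.sqrt else 0

/-- Fidelity `F(ρ,σ) = tr √(√σ ρ √σ)`. -/
noncomputable def fid {n : Type*} [Fintype n] [DecidableEq n]
    (ρ σ : Matrix n n ℂ) : ℝ :=
  (psdSqrt (psdSqrt σ * ρ * psdSqrt σ)).trace.re

/-- Trace norm `‖M‖₁ = tr √(M* M)`. -/
noncomputable def traceNorm {n : Type*} [Fintype n] [DecidableEq n]
    (M : Matrix n n ℂ) : ℝ :=
  (psdSqrt (Mᴴ * M)).trace.re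

/-- Inner product on `ℂ^ι`, conjugate-linear in the first argument. -/
noncomputable def cinner {ι : Type*} [Fintype ι] (x y : ι → ℂ) : ℂ := star x ⬝ᵥ y

/-- Rank-one density operator `φφ*` of a vector `φ`. -/
noncomputable def outer {ι : Type*} [Fintype ι] (φ : ι → ℂ) : Matrix ι ι ℂ :=
  vecMulVec φ (star φ)

lemma psd_sqrt_posSemidef {n : Type*} [Fintype n] [DecidableEq n] {A : Matrix n n ℂ}
    (hA : A.PosSemidef) : hA.sqrt.PosSemidef := by
  unfold Matrix.PosSemidef.sqrt
  have h : (diagonal ((↑) ∘ Real.sqrt ∘ hA.1.eigenvalues) : Matrix n n ℂ).PosSemidef := by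
    rw [Matrix.posSemidef_diagonal_iff]
    intro i
    simp only [Function.comp]
    exact_mod_cast Real.sqrt_nonneg _
  exact h.mul_mul_conjTranspose_same _

lemma psd_sqrt_mul_self {n : Type*} [Fintype n] [DecidableEq n] {A : Matrix n n ℂ}
    (hA : A.PosSemidef) : hA.sqrt * hA.sqrt = A := by
  unfold Matrix.PosSemidef.sqrt
  have hs := hA.1.spectral_theorem
  rw [Unitary.conjStarAlgAut_apply] at hs
  have hu : (star hA.1.eigenvectorUnitary : Matrix n n ℂ) * hA.1.eigenvectorUnitary.1 = 1 :=
    Unitary.coe_star_mul_self _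
  have hd : (diagonal ((↑) ∘ Real.sqrt ∘ hA.1.eigenvalues) : Matrix n n ℂ)
      * diagonal ((↑) ∘ Real.sqrt ∘ hA.1.eigenvalues)
      = diagonal ((↑) ∘ hA.1.eigenvalues) := by
    rw [diagonal_mul_diagonal]
    congr 1
    funext i
    simp only [Function.comp]
    have := Real.mul_self_sqrt (hA.eigenvalues_nonneg i)
    exact_mod_cast this
  generalize (diagonal ((↑) ∘ Real.sqrt ∘ hA.1.eigenvalues) : Matrix n n ℂ) = D at hd ⊢
  generalize (star hA.1.eigenvectorUnitary : Matrix n n ℂ) = W' at *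
  generalize (hA.1.eigenvectorUnitary.1 : Matrix n n ℂ) = W at *
  calc W * D * W' * (W * D * W') = W * (D * (W' * W) * D) * W' := by simp only [Matrix.mul_assoc]
    _ = A := by rw [hu, Matrix.mul_one, hd]; exact hs.symm

lemma psdSqrt_posSemidef {n : Type*} [Fintype n] [DecidableEq n] {A : Matrix n n ℂ}
    (hA : A.PosSemidef) : (psdSqrt A).PosSemidef := by
  rw [psdSqrt, dif_pos hA]; exact psd_sqrt_posSemidef hA

lemma psdSqrt_mul_self {n : Type*} [Fintype n] [DecidableEq n] {A : Matrix n n ℂ}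
    (hA : A.PosSemidef) : psdSqrt A * psdSqrt A = A := by
  rw [psdSqrt, dif_pos hA]; exact psd_sqrt_mul_self hA

lemma fid_eq_zero_iff {n : Type*} [Fintype n] [DecidableEq n] {A B : Matrix n n ℂ}
    (hA : A.PosSemidef) (hB : B.PosSemidef) : fid A B = 0 ↔ (A * B).trace = 0 := by
  have hS := psdSqrt_posSemidef hB
  have hC : (psdSqrt B * A * psdSqrt B).PosSemidef := by
    have := hA.mul_mul_conjTranspose_same (psdSqrt B)
    rwa [hS.1.eq] at this
  have hR := psdSqrt_posSemidef hC
  have htr : (A * B).trace = (psdSqrt B * A * psdSqrt B).trace := by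
    conv_lhs => rw [← psdSqrt_mul_self hB]
    rw [← Matrix.mul_assoc, Matrix.trace_mul_comm, Matrix.mul_assoc]
  rw [htr, hC.trace_eq_zero_iff, fid]
  constructor
  · intro h
    have h0 : (psdSqrt (psdSqrt B * A * psdSqrt B)).trace = 0 :=
      Complex.ext h (Complex.nonneg_iff.1 hR.trace_nonneg).2.symm
    rw [hR.trace_eq_zero_iff] at h0
    rw [← psdSqrt_mul_self hC, h0, Matrix.mul_zero]
  · intro h
    have h2 := psdSqrt_mul_self hC
    have h3 : psdSqrt (psdSqrt B * A * psdSqrt B) = 0 := by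
      rw [← Matrix.conjTranspose_mul_self_eq_zero, hR.1.eq, h2, h]
    rw [h3]; simp

lemma posSemidef_chan {d N : ℕ} (p : Fin N → ℝ) (hp : ∀ i, 0 < p i)
    (U : Fin N → Matrix (Fin d) (Fin d) ℂ) (k : Fin d) :
    (∑ i, (p i : ℂ) • (U i * Matrix.single k k 1 * (U i)ᴴ)).PosSemidef := by
  apply Matrix.posSemidef_sum
  intro i _
  have h1 : (Matrix.single k k (1:ℂ)).PosSemidef := by
    rw [← Matrix.diagonal_single, Matrix.posSemidef_diagonal_iff]
    intro i
    rw [Pi.single_apply]; split_ifs <;> simp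
  exact (h1.mul_mul_conjTranspose_same _).smul (by exact_mod_cast (hp i).le)

lemma trace_term {d : ℕ} (A B : Matrix (Fin d) (Fin d) ℂ) (k l : Fin d) :
    ((A * Matrix.single k k 1 * Aᴴ) * (B * Matrix.single l l 1 * Bᴴ)).trace
      = (Complex.normSq ((Aᴴ * B) k l) : ℂ) := by
  have e : ((A * Matrix.single k k 1 * Aᴴ) * (B * Matrix.single l l 1 * Bᴴ)).trace
     = ((Matrix.single k k 1 * (Aᴴ * B)) * (Matrix.single l l 1 * (Aᴴ * B)ᴴ)).trace := by
    rw [Matrix.conjTranspose_mul, Matrix.conjTranspose_conjTranspose]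
    simp only [Matrix.mul_assoc]
    rw [Matrix.trace_mul_comm]
    simp only [Matrix.mul_assoc]
  rw [e, ← Complex.mul_conj]
  generalize Aᴴ * B = C
  rw [Matrix.trace, Finset.sum_eq_single k]
  · rw [Matrix.diag_apply, Matrix.mul_apply, Finset.sum_eq_single l]
    · simp
    · intro b _ hb; simp [hb]
    · simp
  · intro b _ hb
    rw [Matrix.diag_apply, Matrix.mul_assoc]; simp [hb]
  · simp

lemma fid_chan {d N : ℕ} (p : Fin N → ℝ) (hp : ∀ i, 0 < p i)
    (U : Fin N → Matrix (Fin d) (Fin d) ℂ) (k l : Fin d) :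
    fid (∑ i, (p i : ℂ) • (U i * Matrix.single k k 1 * (U i)ᴴ))
        (∑ i, (p i : ℂ) • (U i * Matrix.single l l 1 * (U i)ᴴ)) = 0 ↔
      ∀ i j, ((U i)ᴴ * U j) k l = 0 := by
  rw [fid_eq_zero_iff (posSemidef_chan p hp U k) (posSemidef_chan p hp U l)]
  have e : ((∑ i, (p i : ℂ) • (U i * Matrix.single k k 1 * (U i)ᴴ)) *
      (∑ i, (p i : ℂ) • (U i * Matrix.single l l 1 * (U i)ᴴ))).trace
      = ((∑ i, ∑ j, p i * (p j * Complex.normSq (((U i)ᴴ * U j) k l)) : ℝ) : ℂ) := by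
    rw [Finset.sum_mul_sum, Matrix.trace_sum]
    push_cast
    refine Finset.sum_congr rfl fun i _ => ?_
    rw [Matrix.trace_sum]
    refine Finset.sum_congr rfl fun j _ => ?_
    rw [Matrix.smul_mul, Matrix.mul_smul, Matrix.trace_smul, Matrix.trace_smul, trace_term]
    simp
  have hn : ∀ i j, 0 ≤ p i * (p j * Complex.normSq (((U i)ᴴ * U j) k l)) := fun i j =>
    mul_nonneg (hp i).le (mul_nonneg (hp j).le (Complex.normSq_nonneg _))
  rw [e, Complex.ofReal_eq_zero,
    Finset.sum_eq_zero_iff_of_nonneg (fun i _ => Finset.sum_nonneg fun j _ => hn i j)]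
  constructor
  · intro h i j
    have h1 := (Finset.sum_eq_zero_iff_of_nonneg (fun j _ => hn i j)).1
      (h i (Finset.mem_univ i)) j (Finset.mem_univ j)
    simpa [(hp i).ne', (hp j).ne'] using h1
  · intro h i _
    simp [h i]

theorem stmt6 (d : ℕ) (N : ℕ) (hN : 1 ≤ N) (p : Fin N → ℝ) (hp : ∀ i, 0 < p i)
    (hpsum : ∑ i, p i = 1)
    (U : Fin N → Matrix (Fin d) (Fin d) ℂ) (hU : ∀ i, (U i)ᴴ * U i = 1)
    (s : ℕ) (hs1 : 1 ≤ s) (hsd : s ≤ d) :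
    (∀ k l : Fin d, k ≠ l → (k : ℕ) < s → (l : ℕ) < s →
      fid (∑ i, (p i : ℂ) • (U i * Matrix.single k k 1 * (U i)ᴴ))
          (∑ i, (p i : ℂ) • (U i * Matrix.single l l 1 * (U i)ᴴ)) = 0) ↔
      ∃ (M : ℕ), 1 ≤ M ∧ ∃ (q : Fin M → ℝ) (V : Fin M → Matrix (Fin d) (Fin d) ℂ),
        (∀ m, 0 < q m) ∧ (∑ m, q m = 1) ∧ (∀ m, (V m)ᴴ * V m = 1) ∧
        (∀ X : Matrix (Fin d) (Fin d) ℂ,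
          ∑ m, (q m : ℂ) • (V m * X * (V m)ᴴ) = ∑ i, (p i : ℂ) • (U i * X * (U i)ᴴ)) ∧
        (∀ m n : Fin M, ∀ k l : Fin d, k ≠ l → (k : ℕ) < s → (l : ℕ) < s →
          ((V n)ᴴ * V m) k l = 0) := by
  constructor
  · intro h
    refine ⟨N, hN, p, U, hp, hpsum, hU, fun X => rfl, ?_⟩
    intro m n k l hkl hk hl
    exact (fid_chan p hp U k l).1 (h k l hkl hk hl) n m
  · rintro ⟨M, hM, q, V, hq, hqs, hV, hX, hz⟩ k l hkl hk hl
    rw [← hX, ← hX, fid_chan q hq V k l]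
    intro i j
    exact hz j i k l hkl hk hl
end

section
/- Let Φ(ρ) = Σ_{i=1}^N pᵢ Uᵢ ρ Uᵢ* be a mixed unitary channel on n×n complex matrices (pᵢ > 0, Σ pᵢ = 1, Uᵢ unitary), and for k ∈ Fin n let E_kk denote the standard basis matrix with a single 1 in position (k,k). Then F(Φ(E_kk), Φ(E_ll)) = 0 for all k ≠ l in Fin n if and only if Φ is unitarily equivalent to a general phase damping channel: there exist an n×n unitary V and diagonal unitary matrices D₁,…,D_N with D₁ = I and (Dᵢ)(0,0) = 1 for all i, such that Φ(ρ) = V · (Σ_{i=1}^N pᵢ Dᵢ ρ Dᵢ*) · V* for every n×n matrix ρ. -/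
open Matrix ComplexOrder

theorem psdSqrt_spec {n : Type*} [Fintype n] [DecidableEq n] {A : Matrix n n ℂ}
    (h : A.PosSemidef) : (psdSqrt A).PosSemidef ∧ psdSqrt A * psdSqrt A = A := by
  have e : psdSqrt A = h.sqrt := by simp [psdSqrt, h]
  rw [e]
  constructor
  · unfold Matrix.PosSemidef.sqrt
    have hd : (diagonal (((↑) : ℝ → ℂ) ∘ Real.sqrt ∘ h.1.eigenvalues)).PosSemidef := by
      apply Matrix.PosSemidef.diagonal
      intro i
      simp [Real.sqrt_nonneg]
    exact hd.mul_mul_conjTranspose_same _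
  · have hs := h.1.spectral_theorem
    rw [Unitary.conjStarAlgAut_apply] at hs
    have hu : (star h.1.eigenvectorUnitary : Matrix n n ℂ) * h.1.eigenvectorUnitary.1 = 1 :=
      Unitary.coe_star_mul_self _
    unfold Matrix.PosSemidef.sqrt
    have hd : diagonal (((↑) : ℝ → ℂ) ∘ Real.sqrt ∘ h.1.eigenvalues) *
        diagonal (((↑) : ℝ → ℂ) ∘ Real.sqrt ∘ h.1.eigenvalues) =
        diagonal (((↑) : ℝ → ℂ) ∘ h.1.eigenvalues) := by
      rw [diagonal_mul_diagonal]
      congr 1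
      funext i
      simp only [Function.comp]
      rw [← Complex.ofReal_mul, Real.mul_self_sqrt (h.eigenvalues_nonneg i)]
    generalize h.1.eigenvectorUnitary = W at *
    generalize diagonal (((↑) : ℝ → ℂ) ∘ Real.sqrt ∘ h.1.eigenvalues) = d at *
    calc W.1 * d * star W.1 * (W.1 * d * star W.1) = W.1 * d * (star W.1 * W.1) * d * star W.1 := by
          simp only [Matrix.mul_assoc]
      _ = W.1 * (d * d) * star W.1 := by rw [hu]; simp only [Matrix.mul_assoc, Matrix.one_mul]
      _ = A := by rw [hd]; exact hs.symm

theorem fid_eq_zero_iff_s15 {n : Type*} [Fintype n] [DecidableEq n] {ρ σ : Matrix n n ℂ}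
    (hρ : ρ.PosSemidef) (hσ : σ.PosSemidef) : fid ρ σ = 0 ↔ (ρ * σ).trace = 0 := by
  obtain ⟨hS, hSS⟩ := psdSqrt_spec hσ
  have hM : (psdSqrt σ * ρ * psdSqrt σ).PosSemidef := by
    have := hρ.mul_mul_conjTranspose_same (psdSqrt σ)
    rwa [hS.1.eq] at this
  have ht : (psdSqrt σ * ρ * psdSqrt σ).trace = (ρ * σ).trace := by
    rw [Matrix.mul_assoc, Matrix.trace_mul_comm, Matrix.mul_assoc, hSS]
  obtain ⟨hT, hTT⟩ := psdSqrt_spec hM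
  rw [← ht, hM.trace_eq_zero_iff]
  unfold fid
  generalize psdSqrt σ * ρ * psdSqrt σ = M at *
  constructor
  · intro h
    have h0 : (psdSqrt M).trace = 0 := by
      have := Complex.nonneg_iff.1 hT.trace_nonneg
      exact Complex.ext h this.2.symm
    rw [hT.trace_eq_zero_iff] at h0
    rw [← hTT, h0, Matrix.mul_zero]
  · intro h
    have h0 : psdSqrt M = 0 := by
      rw [← Matrix.conjTranspose_mul_self_eq_zero, hT.1.eq, hTT, h]
    rw [h0]; simp

theorem chan_psd {n N : ℕ} (p : Fin N → ℝ) (hp : ∀ i, 0 < p i)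
    (U : Fin N → Matrix (Fin n) (Fin n) ℂ) (k : Fin n) :
    (∑ i, (p i : ℂ) • (U i * Matrix.single k k 1 * (U i)ᴴ)).PosSemidef := by
  apply Matrix.posSemidef_sum
  intro i _
  apply Matrix.PosSemidef.smul
  · apply Matrix.PosSemidef.mul_mul_conjTranspose_same
    rw [← Matrix.diagonal_single]
    apply Matrix.PosSemidef.diagonal
    intro j
    by_cases h : j = k
    · subst h; simp
    · simp [h]
  · exact_mod_cast (hp i).le

theorem tr_aux {n : ℕ} (A B : Matrix (Fin n) (Fin n) ℂ) (k l : Fin n) :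
    ((A * Matrix.single k k 1 * Aᴴ) * (B * Matrix.single l l 1 * Bᴴ)).trace
      = (Complex.normSq ((Aᴴ * B) k l) : ℂ) := by
  have h1 : ((A * Matrix.single k k 1 * Aᴴ) * (B * Matrix.single l l 1 * Bᴴ)).trace
      = (Matrix.single k k 1 * ((Aᴴ * B) * Matrix.single l l 1 * (Aᴴ * B)ᴴ)).trace := by
    rw [Matrix.conjTranspose_mul, Matrix.conjTranspose_conjTranspose]
    simp only [Matrix.mul_assoc]
    rw [Matrix.trace_mul_comm]
    simp only [Matrix.mul_assoc]
  rw [h1]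
  generalize Aᴴ * B = M
  rw [Matrix.trace_mul_comm, Matrix.trace_mul_single]
  simp [Matrix.mul_apply, Matrix.single_apply, Complex.normSq_eq_conj_mul_self, mul_comm, ite_and]

theorem chan_tr {n N : ℕ} (p : Fin N → ℝ) 
    (U : Fin N → Matrix (Fin n) (Fin n) ℂ) (k l : Fin n) :
    ((∑ i, (p i : ℂ) • (U i * Matrix.single k k 1 * (U i)ᴴ)) *
      (∑ i, (p i : ℂ) • (U i * Matrix.single l l 1 * (U i)ᴴ))).trace =
    ((∑ i, ∑ j, p i * p j * Complex.normSq (((U i)ᴴ * U j) k l) : ℝ) : ℂ) := by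
  rw [Finset.sum_mul_sum, Matrix.trace_sum]
  push_cast
  refine Finset.sum_congr rfl fun i _ => ?_
  rw [Matrix.trace_sum]
  refine Finset.sum_congr rfl fun j _ => ?_
  rw [Matrix.smul_mul, Matrix.mul_smul, Matrix.trace_smul, Matrix.trace_smul, tr_aux]
  simp [mul_assoc]

theorem chan_iff {n N : ℕ} (p : Fin N → ℝ) (hp : ∀ i, 0 < p i)
    (U : Fin N → Matrix (Fin n) (Fin n) ℂ) (k l : Fin n) :
    fid (∑ i, (p i : ℂ) • (U i * Matrix.single k k 1 * (U i)ᴴ))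
          (∑ i, (p i : ℂ) • (U i * Matrix.single l l 1 * (U i)ᴴ)) = 0 ↔
      ∀ i j, ((U i)ᴴ * U j) k l = 0 := by
  rw [fid_eq_zero_iff_s15 (chan_psd p hp U k) (chan_psd p hp U l), chan_tr, Complex.ofReal_eq_zero]
  have h0 : ∀ i j, 0 ≤ p i * p j * Complex.normSq (((U i)ᴴ * U j) k l) := fun i j =>
    mul_nonneg (mul_nonneg (hp i).le (hp j).le) (Complex.normSq_nonneg _)
  rw [Finset.sum_eq_zero_iff_of_nonneg (fun i _ => Finset.sum_nonneg fun j _ => h0 i j)]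
  constructor
  · intro h i j
    have := (Finset.sum_eq_zero_iff_of_nonneg (fun j _ => h0 i j)).1 (h i (Finset.mem_univ _)) j
      (Finset.mem_univ _)
    have hi := (hp i).ne'
    have hj := (hp j).ne'
    simpa [hi, hj] using this
  · intro h i _
    simp [h]

theorem diag_unit {n : ℕ} {D : Matrix (Fin n) (Fin n) ℂ} (hd : D.IsDiag) (hD : Dᴴ * D = 1)
    (k : Fin n) : star (D k k) * D k k = 1 := by
  have h := congrFun (congrFun hD k) k
  rw [Matrix.mul_apply, Finset.sum_eq_single k] at h
  · simpa using h
  · intro b _ hb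
    rw [hd hb, mul_zero]
  · simp

theorem diag_single {n : ℕ} {D : Matrix (Fin n) (Fin n) ℂ} (hd : D.IsDiag) (hD : Dᴴ * D = 1)
    (k : Fin n) : D * Matrix.single k k 1 * Dᴴ = Matrix.single k k 1 := by
  have hk := diag_unit hd hD k
  rw [← hd.diagonal_diag]
  ext a b
  rw [Matrix.diagonal_conjTranspose, Matrix.mul_diagonal, Matrix.diagonal_mul, Matrix.single_apply]
  split_ifs with h
  · obtain ⟨rfl, rfl⟩ := h
    simpa [mul_comm] using hk
  · simp

theorem stmt15 (n : ℕ) (hn : 0 < n) (N : ℕ) (hN : 0 < N)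
    (p : Fin N → ℝ) (hp : ∀ i, 0 < p i) (hpsum : ∑ i, p i = 1)
    (U : Fin N → Matrix (Fin n) (Fin n) ℂ) (hU : ∀ i, (U i)ᴴ * U i = 1) :
    (∀ k l : Fin n, k ≠ l →
      fid (∑ i, (p i : ℂ) • (U i * Matrix.single k k 1 * (U i)ᴴ))
          (∑ i, (p i : ℂ) • (U i * Matrix.single l l 1 * (U i)ᴴ)) = 0) ↔
      ∃ V : Matrix (Fin n) (Fin n) ℂ, Vᴴ * V = 1 ∧
        ∃ D : Fin N → Matrix (Fin n) (Fin n) ℂ,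
          D ⟨0, hN⟩ = 1 ∧ (∀ i, (D i).IsDiag) ∧ (∀ i, (D i)ᴴ * D i = 1) ∧
          (∀ i, D i ⟨0, hn⟩ ⟨0, hn⟩ = 1) ∧
          (∀ ρ : Matrix (Fin n) (Fin n) ℂ,
            ∑ i, (p i : ℂ) • (U i * ρ * (U i)ᴴ) =
              V * (∑ i, (p i : ℂ) • (D i * ρ * (D i)ᴴ)) * Vᴴ) := by
  simp only [chan_iff p hp U]
  constructor
  · intro h
    have hU0 : U ⟨0, hN⟩ * (U ⟨0, hN⟩)ᴴ = 1 := mul_eq_one_comm.1 (hU _)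
    set V := U ⟨0, hN⟩ with hV
    have hWd : ∀ i, (Vᴴ * U i).IsDiag := fun i k l hkl => h k l hkl _ _
    have hWu : ∀ i, (Vᴴ * U i)ᴴ * (Vᴴ * U i) = 1 := by
      intro i
      rw [Matrix.conjTranspose_mul, Matrix.conjTranspose_conjTranspose, Matrix.mul_assoc,
        ← Matrix.mul_assoc V, hU0, Matrix.one_mul, hU]
    have hc : ∀ i, star ((Vᴴ * U i) ⟨0, hn⟩ ⟨0, hn⟩) * (Vᴴ * U i) ⟨0, hn⟩ ⟨0, hn⟩ = 1 :=
      fun i => diag_unit (hWd i) (hWu i) _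
    have hVW : ∀ i, V * (Vᴴ * U i) = U i := by
      intro i; rw [← Matrix.mul_assoc, hU0, Matrix.one_mul]
    have hW0 : Vᴴ * U ⟨0, hN⟩ = 1 := hU _
    generalize hW : (fun i => Vᴴ * U i) = W at *
    have hW' : ∀ i, Vᴴ * U i = W i := fun i => congrFun hW i
    simp only [hW'] at hWd hWu hc hVW hW0
    refine ⟨V, hU _, fun i => star (W i ⟨0, hn⟩ ⟨0, hn⟩) • W i, ?_, ?_, ?_, ?_, ?_⟩
    · simp [hW0]
    · intro i k l hkl
      simp [hWd i hkl]
    · intro i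
      simp only [Matrix.conjTranspose_smul, Matrix.smul_mul, Matrix.mul_smul, smul_smul, hWu,
        star_star]
      rw [hc, one_smul]
    · intro i
      simpa using hc i
    · intro ρ
      rw [Finset.mul_sum, Finset.sum_mul]
      refine Finset.sum_congr rfl fun i _ => ?_
      rw [Matrix.mul_smul, Matrix.smul_mul]
      congr 1
      simp only [Matrix.conjTranspose_smul, Matrix.smul_mul, Matrix.mul_smul, smul_smul,
        star_star]
      rw [mul_comm, hc, one_smul]
      conv_lhs => rw [← hVW i]
      simp only [Matrix.conjTranspose_mul, Matrix.mul_assoc]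
  · rintro ⟨V, hV, D, -, hD, hDu, -, hΦ⟩ k l hkl
    rw [← chan_iff p hp U, fid_eq_zero_iff_s15 (chan_psd p hp U k) (chan_psd p hp U l), hΦ, hΦ]
    have hs : ∀ k, ∑ i, (p i : ℂ) • (D i * Matrix.single k k 1 * (D i)ᴴ) =
        (Matrix.single k k 1 : Matrix (Fin n) (Fin n) ℂ) := by
      intro k
      simp only [diag_single (hD _) (hDu _)]
      rw [← Finset.sum_smul, ← Complex.ofReal_sum, hpsum]
      simp
    rw [hs, hs, tr_aux, hV]
    simp [hkl]
end
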